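/- Let A : Fin d → Matrix (Fin D₁) (Fin D₁) ℂ be in left canonical form, i.e. ∑_{i} (A(i))ᴴ * A(i) = 1, and suppose the transfer matrix E = ∑_{i} A(i) ⊗ₖ conj(A(i)) (Kronecker product with the entrywise complex conjugate) satisfies E^m → (vec Λ)·(vec 1)ᵀ as m → ∞, where Λ is a positive-definite D₁ × D₁ matrix with trace 1, 1 is the identity matrix, and vec denotes vectorization (this encodes normality of A). Let D ≥ 1, let 0 ≤ ε < 1/(4D), and let N₀ ∈ ℕ be such that for every N > N₀ one has ψ_N(A) ≠ 0 and the normalized state ψ_N(A)/‖ψ_N(A)‖ has the MPS-up(ε,D) property. Then for every N the state ψ_N(A) is a translationally invariant product state: there exist K_N ∈ ℂ and φ : Fin d → ℂ with ψ_N(A)(i) = K_N · ∏_{n} φ(i n) for all i. -/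

import Mathlib

open scoped Kronecker Matrix ComplexOrder

/-- The matrix of a state `ψ` across the bipartition `(S, Sᶜ)` of the sites. -/
noncomputable def schmidtMat {N d : ℕ} (ψ : (Fin N → Fin d) → ℂ) (S : Finset (Fin N)) :
    Matrix ({n : Fin N // n ∈ S} → Fin d) ({n : Fin N // n ∉ S} → Fin d) ℂ :=
  fun j k => ψ fun n => if h : n ∈ S then j ⟨n, h⟩ else k ⟨n, h⟩

/-- The Schmidt rank of `ψ` across the subset `S` of sites. -/
noncomputable def schmidtRank {N d : ℕ} (ψ : (Fin N → Fin d) → ℂ) (S : Finset (Fin N)) : ℕ :=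
  (schmidtMat ψ S).rank

/-- The ℓ²-norm of a coefficient tensor. -/
noncomputable def l2norm {ι : Type} [Fintype ι] (ψ : ι → ℂ) : ℝ :=
  Real.sqrt (∑ x, ‖ψ x‖ ^ 2)

/-- The translationally invariant MPS with site tensor `A` on `N` sites. -/
noncomputable def psiTI (N : ℕ) {d D₁ : ℕ} (A : Fin d → Matrix (Fin D₁) (Fin D₁) ℂ) :
    (Fin N → Fin d) → ℂ :=
  fun i => ((List.ofFn fun n => A (i n)).prod).trace

/-- The transfer matrix `E = ∑ i, A i ⊗ₖ conj (A i)`. -/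
noncomputable def transferE {d D₁ : ℕ} (A : Fin d → Matrix (Fin D₁) (Fin D₁) ℂ) :
    Matrix (Fin D₁ × Fin D₁) (Fin D₁ × Fin D₁) ℂ :=
  ∑ i, A i ⊗ₖ (A i).map (starRingEnd ℂ)

lemma sum_list_prod {R T : Type*} [Semiring R] [Fintype T] : ∀ (N : ℕ) (f : Fin N → T → R),
    ∑ i : Fin N → T, (List.ofFn fun n => f n (i n)).prod = (List.ofFn fun n => ∑ t, f n t).prod
  | 0, f => by simp
  | N+1, f => by
    rw [← (Fin.consEquiv (fun _ => T)).sum_comp, Fintype.sum_prod_type]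
    simp only [List.ofFn_succ, List.prod_cons, Fin.consEquiv_apply, Fin.cons_zero, Fin.cons_succ]
    rw [← sum_list_prod N, Finset.sum_mul]
    refine Finset.sum_congr rfl fun t _ => ?_
    rw [Finset.mul_sum]

lemma kron_list {m n : Type*} [Fintype m] [Fintype n] [DecidableEq m] [DecidableEq n] :
    ∀ (N : ℕ) (f : Fin N → Matrix m m ℂ) (g : Fin N → Matrix n n ℂ),
    (List.ofFn f).prod ⊗ₖ (List.ofFn g).prod = (List.ofFn fun k => f k ⊗ₖ g k).prod
  | 0, f, g => by simp
  | N+1, f, g => by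
    simp only [List.ofFn_succ, List.prod_cons]
    rw [Matrix.mul_kronecker_mul, kron_list N]

lemma conj_list {m : Type*} [Fintype m] [DecidableEq m] (N : ℕ) (f : Fin N → Matrix m m ℂ) :
    (List.ofFn fun k => (f k).map (starRingEnd ℂ)).prod = (List.ofFn f).prod.map (starRingEnd ℂ) := by
  have := map_list_prod ((starRingEnd ℂ).mapMatrix (m := m)) (List.ofFn f)
  rw [List.map_ofFn] at this
  exact this.symm

lemma conj_psi {N d D₁ : ℕ} (A : Fin d → Matrix (Fin D₁) (Fin D₁) ℂ) (i : Fin N → Fin d) :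
    starRingEnd ℂ (psiTI N A i) = (List.ofFn fun n => (A (i n)).map (starRingEnd ℂ)).prod.trace := by
  rw [conj_list]
  simp [psiTI, Matrix.trace]

lemma norm_psi {N d D₁ : ℕ} (A : Fin d → Matrix (Fin D₁) (Fin D₁) ℂ) :
    ((∑ i, ‖psiTI N A i‖ ^ 2 : ℝ) : ℂ) = (transferE A ^ N).trace := by
  push_cast
  simp only [← Complex.mul_conj', conj_psi]
  simp only [psiTI, ← Matrix.trace_kronecker, kron_list]
  rw [← Matrix.trace_sum, sum_list_prod N (fun _ t => A t ⊗ₖ (A t).map (starRingEnd ℂ))]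
  simp [transferE]

def mix {N d : ℕ} (S : Finset (Fin N)) (i i' : Fin N → Fin d) : Fin N → Fin d :=
  fun n => if n ∈ S then i n else i' n

noncomputable def pur {m n : Type*} [Fintype m] [Fintype n] (M : Matrix m n ℂ) : ℝ :=
  ∑ j, ∑ j', ‖∑ k, M j k * starRingEnd ℂ (M j' k)‖ ^ 2

lemma pur_eq {N d : ℕ} (ψ : (Fin N → Fin d) → ℂ) (S : Finset (Fin N)) :
    (pur (schmidtMat ψ S) : ℂ) = ∑ p : (Fin N → Fin d) × (Fin N → Fin d),
      (ψ p.1 * starRingEnd ℂ (ψ (mix S p.1 p.2))) * (ψ p.2 * starRingEnd ℂ (ψ (mix S p.2 p.1))) := by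
  have e := (Equiv.piEquivPiSubtypeProd (fun n => n ∈ S) (fun _ : Fin N => Fin d)).symm
  rw [Fintype.sum_prod_type]
  simp only [← (Equiv.piEquivPiSubtypeProd (fun n => n ∈ S) (fun _ : Fin N => Fin d)).symm.sum_comp, Fintype.sum_prod_type]
  unfold pur
  push_cast
  simp only [← Complex.mul_conj', map_sum, Finset.sum_mul_sum]
  refine Finset.sum_congr rfl fun j _ => ?_
  rw [Finset.sum_comm]
  refine Finset.sum_congr rfl fun k _ => ?_
  refine Finset.sum_congr rfl fun j' _ => ?_
  refine Finset.sum_congr rfl fun k' _ => ?_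
  have h : ∀ (a b : {n : Fin N // n ∈ S} → Fin d) (a' b' : {n : Fin N // n ∉ S} → Fin d),
    mix S ((Equiv.piEquivPiSubtypeProd (fun n => n ∈ S) (fun _ : Fin N => Fin d)).symm (a, a'))
     ((Equiv.piEquivPiSubtypeProd (fun n => n ∈ S) (fun _ : Fin N => Fin d)).symm (b, b')) = 
     (Equiv.piEquivPiSubtypeProd (fun n => n ∈ S) (fun _ : Fin N => Fin d)).symm (a, b') := by
    intro a b a' b'
    funext n
    by_cases h : n ∈ S <;> simp [mix, h]
  have h2 : ∀ a a', schmidtMat ψ S a a' = ψ ((Equiv.piEquivPiSubtypeProd (fun n => n ∈ S) (fun _ : Fin N => Fin d)).symm (a, a')) := 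
    fun a a' => rfl
  simp only [h, h2, map_mul, Complex.conj_conj]
  ring

def sg (D₁ : ℕ) (p : (Fin D₁ × Fin D₁) × (Fin D₁ × Fin D₁)) : (Fin D₁ × Fin D₁) × (Fin D₁ × Fin D₁) :=
  ((p.1.1, p.2.2), (p.2.1, p.1.2))

lemma sg_inv {D₁ : ℕ} : Function.Involutive (sg D₁) := fun _ => rfl

noncomputable def G1 {d D₁ : ℕ} (A : Fin d → Matrix (Fin D₁) (Fin D₁) ℂ) := transferE A ⊗ₖ transferE A

noncomputable def sgE (D₁ : ℕ) := (sg_inv (D₁ := D₁)).toPerm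

lemma pur_psi {N d D₁ : ℕ} (A : Fin d → Matrix (Fin D₁) (Fin D₁) ℂ) (S : Finset (Fin N)) :
    (pur (schmidtMat (psiTI N A) S) : ℂ) =
      (List.ofFn fun n => if n ∈ S then G1 A else (G1 A).submatrix (sgE D₁) (sgE D₁)).prod.trace := by
  rw [pur_eq]
  simp only [conj_psi]
  simp only [psiTI, ← Matrix.trace_kronecker, kron_list]
  rw [← Matrix.trace_sum, ← (Equiv.arrowProdEquivProdArrow (Fin N) (fun _ => Fin d) (fun _ => Fin d)).sum_comp]
  have := sum_list_prod N (fun n (t : Fin d × Fin d) => 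
    (A t.1 ⊗ₖ (A (if n ∈ S then t.1 else t.2)).map (starRingEnd ℂ)) ⊗ₖ
    (A t.2 ⊗ₖ (A (if n ∈ S then t.2 else t.1)).map (starRingEnd ℂ)))
  simp only [Equiv.arrowProdEquivProdArrow, mix, Equiv.coe_fn_mk]
  rw [this]
  congr 3
  funext n
  by_cases h : n ∈ S
  · simp only [h, if_true]
    ext p q
    simp [G1, transferE, Matrix.sum_apply, Matrix.kroneckerMap_apply, Finset.sum_mul_sum, Fintype.sum_prod_type]
  · simp only [h, if_false]
    ext p q
    simp only [G1, transferE, Matrix.sum_apply, Matrix.kroneckerMap_apply, Finset.sum_mul_sum, Fintype.sum_prod_type, Matrix.submatrix_apply, sgE, sg, Function.Involutive.coe_toPerm, Matrix.map_apply]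
    refine Finset.sum_congr rfl fun _ _ => Finset.sum_congr rfl fun _ _ => ?_
    ring

lemma rank_approx {m n : Type*} [Fintype m] [Fintype n] [DecidableEq m] [DecidableEq n] (D : ℕ) (M F : Matrix m n ℂ)
    (hF : F.rank ≤ D) :
    ∑ j, ∑ k, ‖M j k‖ ^ 2 - D * Real.sqrt (pur M) ≤ ∑ j, ∑ k, ‖M j k - F j k‖ ^ 2 := by
  let W : Submodule ℂ (EuclideanSpace ℂ m) := Submodule.span ℂ (Set.range fun k => WithLp.toLp 2 (F.col k))
  have hW : Module.finrank ℂ W = F.rank := by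
    rw [Matrix.rank_eq_finrank_span_cols]
    have : W = (Submodule.span ℂ (Set.range F.col)).map (WithLp.linearEquiv 2 ℂ (m → ℂ)).symm.toLinearMap := by
      rw [Submodule.map_span, ← Set.range_comp]; rfl
    rw [this]
    exact LinearEquiv.finrank_map_eq _ _
  let b := stdOrthonormalBasis ℂ W
  let x : n → EuclideanSpace ℂ m := fun k => WithLp.toLp 2 (M.col k)
  let y : n → EuclideanSpace ℂ m := fun k => WithLp.toLp 2 (F.col k)
  have hx : ∀ k, ‖x k‖ ^ 2 = ∑ j, ‖M j k‖ ^ 2 := fun k => by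
    rw [EuclideanSpace.norm_sq_eq]; rfl
  have hxy : ∀ k, ‖x k - y k‖ ^ 2 = ∑ j, ‖M j k - F j k‖ ^ 2 := fun k => by
    rw [EuclideanSpace.norm_sq_eq]; rfl
  have h1 : ∀ k, ‖x k‖ ^ 2 - ∑ a, ‖inner ℂ (b a : EuclideanSpace ℂ m) (x k)‖ ^ 2 ≤ ‖x k - y k‖ ^ 2 := by
    intro k
    have hy : y k ∈ W := Submodule.subset_span ⟨k, rfl⟩
    have e1 : ‖x k‖ ^ 2 = ‖W.orthogonalProjectionOnto (x k)‖ ^ 2 + ‖x k - W.orthogonalProjectionOnto (x k)‖ ^ 2 := by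
      rw [Submodule.norm_sq_eq_add_norm_sq_projection (x k) W, Submodule.coe_norm (Wᗮ.orthogonalProjectionOnto (x k)),
        ← Submodule.starProjection_apply, Submodule.starProjection_orthogonal_val]
      rfl
    have e2 : ‖W.orthogonalProjectionOnto (x k)‖ ^ 2 = ∑ a, ‖inner ℂ (b a : EuclideanSpace ℂ m) (x k)‖ ^ 2 := by
      rw [← b.sum_sq_norm_inner_right]
      refine Finset.sum_congr rfl fun a _ => ?_
      rw [Submodule.inner_orthogonalProjectionOnto_eq_of_mem_left]
    have e3 : ‖x k - W.orthogonalProjectionOnto (x k)‖ ≤ ‖x k - y k‖ := by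
      have := Submodule.starProjection_minimal (U := W) (x k)
      rw [Submodule.starProjection_apply] at this
      rw [this]
      exact ciInf_le ⟨0, by rintro _ ⟨w, rfl⟩; positivity⟩ (⟨y k, hy⟩ : W)
    have := pow_le_pow_left₀ (norm_nonneg _) e3 2
    linarith
  have h2 : ∀ a, ∑ k, ‖inner ℂ (b a : EuclideanSpace ℂ m) (x k)‖ ^ 2 ≤ Real.sqrt (pur M) := by
    intro a
    set e : EuclideanSpace ℂ m := (b a : W).1 with he
    have hn : ∑ j, ‖e j‖ ^ 2 = 1 := by
      rw [← EuclideanSpace.norm_sq_eq, he]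
      have := b.orthonormal.1 a
      rw [Submodule.coe_norm] at this
      rw [this, one_pow]
    apply Real.le_sqrt_of_sq_le
    have e1 : ((∑ k, ‖inner ℂ e (x k)‖ ^ 2 : ℝ) : ℂ) = ∑ p : m × m, (∑ k, M p.1 k * starRingEnd ℂ (M p.2 k)) * (starRingEnd ℂ (e p.1) * e p.2) := by
      push_cast
      simp only [← Complex.mul_conj', PiLp.inner_apply, map_sum, Finset.sum_mul_sum, Fintype.sum_prod_type]
      rw [Finset.sum_comm]
      refine Finset.sum_congr rfl fun j _ => ?_
      rw [Finset.sum_comm]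
      refine Finset.sum_congr rfl fun j' _ => ?_
      rw [Finset.sum_mul]
      refine Finset.sum_congr rfl fun k _ => ?_
      simp [x, Matrix.col]
      ring
    have e2 : ∑ k, ‖inner ℂ e (x k)‖ ^ 2 ≤ ∑ p : m × m, ‖∑ k, M p.1 k * starRingEnd ℂ (M p.2 k)‖ * (‖e p.1‖ * ‖e p.2‖) := by
      have : ∑ k, ‖inner ℂ e (x k)‖ ^ 2 = ‖((∑ k, ‖inner ℂ e (x k)‖ ^ 2 : ℝ) : ℂ)‖ := by
        rw [Complex.norm_real, Real.norm_of_nonneg (by positivity)]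
      rw [this, e1]
      refine (norm_sum_le _ _).trans (le_of_eq ?_)
      simp
    calc _ ≤ (∑ p : m × m, ‖∑ k, M p.1 k * starRingEnd ℂ (M p.2 k)‖ * (‖e p.1‖ * ‖e p.2‖)) ^ 2 :=
          pow_le_pow_left₀ (by positivity) e2 2
      _ ≤ (∑ p : m × m, ‖∑ k, M p.1 k * starRingEnd ℂ (M p.2 k)‖ ^ 2) * ∑ p : m × m, (‖e p.1‖ * ‖e p.2‖) ^ 2 :=
          Finset.sum_mul_sq_le_sq_mul_sq _ _ _
      _ = pur M := by
          have : ∑ p : m × m, (‖e p.1‖ * ‖e p.2‖) ^ 2 = 1 := by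
            simp only [mul_pow, Fintype.sum_prod_type, ← Finset.sum_mul_sum, hn, mul_one]
          rw [this, mul_one, Fintype.sum_prod_type]; rfl
  have h3 : ∑ k, ∑ a, ‖inner ℂ (b a : EuclideanSpace ℂ m) (x k)‖ ^ 2 ≤ D * Real.sqrt (pur M) := by
    rw [Finset.sum_comm]
    refine (Finset.sum_le_sum fun a _ => h2 a).trans ?_
    rw [Finset.sum_const, nsmul_eq_mul, Finset.card_univ, Fintype.card_fin, hW]
    gcongr
  have h4 := Finset.sum_le_sum fun k (_ : k ∈ Finset.univ) => h1 k
  rw [Finset.sum_sub_distrib] at h4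
  simp only [hx, hxy] at h4
  rw [Finset.sum_comm, Finset.sum_comm (s := Finset.univ (α := m)) (f := fun j k => ‖M j k - F j k‖ ^ 2)]
  linarith

open Filter Topology

lemma purity_lt {D₁ : ℕ} (h2 : 2 ≤ D₁) (Λ : Matrix (Fin D₁) (Fin D₁) ℂ) (hΛ : Λ.PosDef) (hΛtr : Λ.trace = 1) :
    ∃ γ : ℝ, 0 ≤ γ ∧ γ < 1 ∧ (Λ * Λ).trace = (γ : ℂ) := by
  have hH := hΛ.isHermitian
  set μ := hH.eigenvalues with hμ
  have hpos : ∀ i, 0 < μ i := hΛ.eigenvalues_pos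
  have hsum : ∑ i, μ i = 1 := by
    have := hH.trace_eq_sum_eigenvalues
    rw [hΛtr] at this
    apply Complex.ofReal_injective
    push_cast
    exact this.symm
  refine ⟨∑ i, μ i ^ 2, by positivity, ?_, ?_⟩
  · rw [← hsum]
    have hlt : ∀ i, μ i < 1 := by
      intro i
      rw [← hsum]
      obtain ⟨j, hj⟩ : ∃ j : Fin D₁, j ≠ i := by
        have : Nontrivial (Fin D₁) := Fin.nontrivial_iff_two_le.2 h2
        exact exists_ne i
      exact Finset.single_lt_sum hj (Finset.mem_univ i) (Finset.mem_univ j) (hpos j) fun k _ _ => (hpos k).le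
    refine Finset.sum_lt_sum_of_nonempty ⟨⟨0, by omega⟩, Finset.mem_univ _⟩ fun i _ => ?_
    nlinarith [hpos i, hlt i]
  · have hs := hH.spectral_theorem
    have : Λ * Λ = Unitary.conjStarAlgAut ℂ _ hH.eigenvectorUnitary
       (Matrix.diagonal (RCLike.ofReal ∘ hH.eigenvalues) * Matrix.diagonal (RCLike.ofReal ∘ hH.eigenvalues)) := by
      rw [map_mul, ← hs]
    rw [this, Unitary.conjStarAlgAut_apply, Matrix.trace_mul_comm, ← mul_assoc]
    simp [Matrix.diagonal_mul_diagonal, Matrix.trace_diagonal, sq, hμ]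

lemma block_prod {R : Type*} [Monoid R] (X Y : R) (k m : ℕ) :
    (List.ofFn fun n : Fin (k * (m + m)) => if n ∈ (Finset.univ.filter fun n : Fin (k * (m + m)) => n.1 % (m + m) < m)
      then X else Y).prod = (X ^ m * Y ^ m) ^ k := by
  rw [List.ofFn_mul, List.prod_flatten, List.map_ofFn]
  have : ∀ i : Fin k, ((List.prod ∘ fun i : Fin k => List.ofFn fun j : Fin (m + m) => if (⟨i * (m + m) + j, by
        calc i * (m+m) + j < (i + 1) * (m+m) := by have := j.2; linarith
        _ ≤ _ := Nat.mul_le_mul_right _ i.2⟩ : Fin (k * (m+m))) ∈ (Finset.univ.filter fun n : Fin (k * (m + m)) => n.1 % (m + m) < m)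
      then X else Y) i) = X ^ m * Y ^ m := by
    intro i
    simp only [Function.comp, Finset.mem_filter, Finset.mem_univ, true_and]
    rw [List.ofFn_add]
    have h1 : ∀ j : Fin m, (i.1 * (m + m) + j.1) % (m + m) < m := by
      intro j
      rw [Nat.mul_add_mod', Nat.mod_eq_of_lt (by omega)]
      exact j.2
    have h2 : ∀ j : Fin m, ¬ (i.1 * (m + m) + (m + j.1)) % (m + m) < m := by
      intro j
      rw [Nat.mul_add_mod', Nat.mod_eq_of_lt (by omega)]
      omega
    simp only [Fin.val_castLE, Fin.val_natAdd, h1, h2, if_true, if_false, List.ofFn_const, List.prod_append, List.prod_replicate]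
  refine (congrArg (fun f => (List.ofFn f).prod) (funext this)).trans ?_
  simp only [List.ofFn_const, List.prod_replicate]

lemma E_tendsto {d D₁ : ℕ} (A : Fin d → Matrix (Fin D₁) (Fin D₁) ℂ) (Λ : Matrix (Fin D₁) (Fin D₁) ℂ)
    (hnormal : ∀ p q : Fin D₁ × Fin D₁,
      Filter.Tendsto (fun m => (transferE A ^ m) p q) Filter.atTop
        (nhds (Λ p.1 p.2 * (1 : Matrix (Fin D₁) (Fin D₁) ℂ) q.1 q.2))) :
    Tendsto (fun m => transferE A ^ m) atTop (𝓝 (Matrix.vecMulVec (fun p => Λ p.1 p.2) (fun q => (1 : Matrix (Fin D₁) (Fin D₁) ℂ) q.1 q.2))) :=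
  tendsto_pi_nhds.2 fun p => tendsto_pi_nhds.2 fun q => hnormal p q

lemma trace_vmv_pow {n : Type*} [Fintype n] [DecidableEq n] (u v : n → ℂ) (k : ℕ) :
    (Matrix.vecMulVec u v ^ (k + 1)).trace = (v ⬝ᵥ u) ^ (k + 1) := by
  have : Matrix.vecMulVec u v ^ (k + 1) = (v ⬝ᵥ u) ^ k • Matrix.vecMulVec u v := by
    induction k with
    | zero => simp
    | succ k ih => 
      rw [pow_succ, ih, Matrix.smul_mul, Matrix.vecMulVec_mul_vecMulVec, pow_succ, mul_smul]
      congr 1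
      ext i j
      simp [Matrix.vecMulVec_apply]
      try ring
  rw [this, Matrix.trace_smul, Matrix.trace_vecMulVec, dotProduct_comm u v, pow_succ, smul_eq_mul]

lemma G_tendsto {d D₁ : ℕ} (A : Fin d → Matrix (Fin D₁) (Fin D₁) ℂ) (Λ : Matrix (Fin D₁) (Fin D₁) ℂ)
    (hnormal : ∀ p q : Fin D₁ × Fin D₁,
      Filter.Tendsto (fun m => (transferE A ^ m) p q) Filter.atTop
        (nhds (Λ p.1 p.2 * (1 : Matrix (Fin D₁) (Fin D₁) ℂ) q.1 q.2))) (k : ℕ) :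
    Tendsto (fun m => (((G1 A) ^ m * ((G1 A).submatrix (sgE D₁) (sgE D₁)) ^ m) ^ (k + 1)).trace) atTop
      (𝓝 (((Λ * Λ).trace * (Λ * Λ).trace) ^ (k + 1))) := by
  have hp : ∀ m, G1 A ^ m = (transferE A ^ m) ⊗ₖ (transferE A ^ m) := by
    intro m
    induction m with
    | zero => simp
    | succ m ih => rw [pow_succ, ih, G1, ← Matrix.mul_kronecker_mul, ← pow_succ]
  have hq : ∀ m, ((G1 A).submatrix (sgE D₁) (sgE D₁)) ^ m = (G1 A ^ m).submatrix (sgE D₁) (sgE D₁) := by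
    intro m
    induction m with
    | zero => simp
    | succ m ih => rw [pow_succ, ih, Matrix.submatrix_mul_equiv, ← pow_succ]
  let u : (Fin D₁ × Fin D₁) × (Fin D₁ × Fin D₁) → ℂ := fun p => Λ p.1.1 p.1.2 * Λ p.2.1 p.2.2
  let v : (Fin D₁ × Fin D₁) × (Fin D₁ × Fin D₁) → ℂ := fun p => 
    (1 : Matrix (Fin D₁) (Fin D₁) ℂ) p.1.1 p.1.2 * (1 : Matrix (Fin D₁) (Fin D₁) ℂ) p.2.1 p.2.2
  have h1 : Tendsto (fun m => G1 A ^ m) atTop (𝓝 (Matrix.vecMulVec u v)) := by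
    refine tendsto_pi_nhds.2 fun p => tendsto_pi_nhds.2 fun q => ?_
    simp only [hp, Matrix.kroneckerMap_apply]
    convert! (hnormal p.1 q.1).mul (hnormal p.2 q.2) using 2
    simp only [Matrix.vecMulVec_apply, u, v]
    ring
  have h2 : Tendsto (fun m => ((G1 A).submatrix (sgE D₁) (sgE D₁)) ^ m) atTop (𝓝 (Matrix.vecMulVec (u ∘ sgE D₁) (v ∘ sgE D₁))) := by
    refine tendsto_pi_nhds.2 fun p => tendsto_pi_nhds.2 fun q => ?_
    simp only [hq]
    exact (tendsto_pi_nhds.1 (tendsto_pi_nhds.1 h1 (sgE D₁ p))) (sgE D₁ q)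
  have h3 := ((h1.mul h2).pow (k + 1))
  have h4 : Continuous (Matrix.trace : Matrix ((Fin D₁ × Fin D₁) × (Fin D₁ × Fin D₁)) ((Fin D₁ × Fin D₁) × (Fin D₁ × Fin D₁)) ℂ → ℂ) :=
    continuous_id.matrix_trace
  have h5 := (h4.tendsto _).comp h3
  convert! h5 using 2
  have e1 : v ⬝ᵥ (u ∘ sgE D₁) = (Λ * Λ).trace := by
    simp [dotProduct, Fintype.sum_prod_type, u, v, sgE, sg, Matrix.one_apply, Matrix.trace, Matrix.mul_apply]
  have e2 : (v ∘ sgE D₁) ⬝ᵥ u = (Λ * Λ).trace := by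
    rw [← e1]
    simp only [dotProduct]
    rw [← Equiv.sum_comp (sgE D₁) (fun p => v p * (u ∘ sgE D₁) p)]
    rfl
  rw [Matrix.vecMulVec_mul_vecMulVec, trace_vmv_pow, e1, smul_dotProduct, e2, smul_eq_mul]

lemma final_ineq {d D₁ : ℕ} (h2 : 2 ≤ D₁)
    (A : Fin d → Matrix (Fin D₁) (Fin D₁) ℂ)
    (Λ : Matrix (Fin D₁) (Fin D₁) ℂ) (hΛ : Λ.PosDef) (hΛtr : Λ.trace = 1)
    (hnormal : ∀ p q : Fin D₁ × Fin D₁,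
      Filter.Tendsto (fun m => (transferE A ^ m) p q) Filter.atTop
        (nhds (Λ p.1 p.2 * (1 : Matrix (Fin D₁) (Fin D₁) ℂ) q.1 q.2)))
    (D : ℕ) (ε : ℝ) (hε0 : 0 ≤ ε) (hε1 : ε < 1)
    (N₀ : ℕ)
    (hup : ∀ N : ℕ, N₀ < N → psiTI N A ≠ 0 ∧
      ∀ S : Finset (Fin N), ∃ φ : (Fin N → Fin d) → ℂ,
        l2norm (fun i => psiTI N A i / (l2norm (psiTI N A) : ℂ) - φ i) ≤ ε ∧
        schmidtRank φ S ≤ D) : False := by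
  obtain ⟨γ, hγ0, hγ1, hγ⟩ := purity_lt h2 Λ hΛ hΛtr
  -- the basic inequality
  have key : ∀ N, N₀ < N → ∀ S : Finset (Fin N),
      (1 - ε ^ 2) * (∑ i, ‖psiTI N A i‖ ^ 2) ≤ D * Real.sqrt (pur (schmidtMat (psiTI N A) S)) := by
    intro N hN S
    obtain ⟨hne, hS⟩ := hup N hN
    obtain ⟨φ, hφ, hr⟩ := hS S
    have sum_sch : ∀ χ : (Fin N → Fin d) → ℂ, ∑ j, ∑ k, ‖schmidtMat χ S j k‖ ^ 2 = ∑ i, ‖χ i‖ ^ 2 := by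
      intro χ
      rw [← (Equiv.piEquivPiSubtypeProd (fun n => n ∈ S) (fun _ : Fin N => Fin d)).symm.sum_comp, Fintype.sum_prod_type]
      rfl
    set c : ℝ := l2norm (psiTI N A) with hc
    have hc2 : c ^ 2 = ∑ i, ‖psiTI N A i‖ ^ 2 := Real.sq_sqrt (by positivity)
    have hcpos : 0 < c := by
      apply Real.sqrt_pos.2
      obtain ⟨i, hi⟩ := Function.ne_iff.1 hne
      exact Finset.sum_pos' (fun _ _ => by positivity) ⟨i, Finset.mem_univ _, by have := norm_pos_iff.2 hi; positivity⟩
    have hcC : (c : ℂ) ≠ 0 := by exact_mod_cast hcpos.ne'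
    have h := rank_approx D (schmidtMat (psiTI N A) S) ((c : ℂ) • schmidtMat φ S) 
      (by
        refine le_trans ?_ hr
        exact (Matrix.rank_smul_of_mem_nonZeroDivisors _ (mem_nonZeroDivisors_of_ne_zero hcC)).le)
    rw [sum_sch] at h
    have h' : ∑ j, ∑ k, ‖schmidtMat (psiTI N A) S j k - ((c : ℂ) • schmidtMat φ S) j k‖ ^ 2 ≤ c ^ 2 * ε ^ 2 := by
      have := sum_sch (fun i => psiTI N A i - c * φ i)
      refine (le_of_eq this).trans ?_
      have h1 : ∑ i, ‖psiTI N A i / (c : ℂ) - φ i‖ ^ 2 ≤ ε ^ 2 := by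
        have := pow_le_pow_left₀ (Real.sqrt_nonneg _) hφ 2
        unfold l2norm at this
        rwa [Real.sq_sqrt (by positivity)] at this
      have h2 : ∀ i, ‖psiTI N A i - c * φ i‖ ^ 2 = c ^ 2 * ‖psiTI N A i / (c : ℂ) - φ i‖ ^ 2 := by
        intro i
        have : psiTI N A i - c * φ i = c * (psiTI N A i / (c : ℂ) - φ i) := by field_simp
        rw [this, norm_mul, mul_pow, Complex.norm_real, Real.norm_of_nonneg hcpos.le]
      simp only [h2, ← Finset.mul_sum]
      gcongr
    rw [← hc2] at h ⊢
    linarith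
  have key2 : ∀ N, N₀ < N → ∀ S : Finset (Fin N),
      (1 - ε ^ 2) ^ 2 * (∑ i, ‖psiTI N A i‖ ^ 2) ^ 2 ≤ D ^ 2 * pur (schmidtMat (psiTI N A) S) := by
    intro N hN S
    have h0 : 0 ≤ 1 - ε ^ 2 := by nlinarith
    have := pow_le_pow_left₀ (by positivity) (key N hN S) 2
    rwa [mul_pow, mul_pow, Real.sq_sqrt (by unfold pur; positivity)] at this
  have key3 : ∀ k : ℕ, (1 - ε ^ 2) ^ 2 ≤ D ^ 2 * (γ * γ) ^ (k + 1) := by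
    intro k
    have hN : Tendsto (fun m => (k + 1) * (m + m)) atTop atTop := 
      tendsto_atTop_mono (fun m => by simp only [id]; nlinarith [Nat.zero_le (k * m)]) tendsto_id
    have l1 : Tendsto (fun m => ∑ i, ‖psiTI ((k + 1) * (m + m)) A i‖ ^ 2) atTop (𝓝 1) := by
      have h4 : Continuous (Matrix.trace : Matrix (Fin D₁ × Fin D₁) (Fin D₁ × Fin D₁) ℂ → ℂ) :=
        continuous_id.matrix_trace
      have := ((h4.tendsto _).comp (E_tendsto A Λ hnormal)).comp hN
      have e : (Matrix.vecMulVec (fun p : Fin D₁ × Fin D₁ => Λ p.1 p.2) (fun q => (1 : Matrix (Fin D₁) (Fin D₁) ℂ) q.1 q.2)).trace = 1 := by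
        rw [← hΛtr]
        rw [Matrix.trace_vecMulVec]
        simp [dotProduct, Fintype.sum_prod_type, Matrix.one_apply, Matrix.trace]
      rw [e] at this
      have h5 := (Complex.continuous_re.tendsto _).comp this
      convert! h5 using 2 with m
      simp only [Function.comp, ← norm_psi, Complex.ofReal_re]
    have l2 : Tendsto (fun m => pur (schmidtMat (psiTI ((k + 1) * (m + m)) A) 
        (Finset.univ.filter fun n : Fin ((k + 1) * (m + m)) => n.1 % (m + m) < m))) atTop (𝓝 ((γ * γ) ^ (k + 1))) := by
      have := G_tendsto A Λ hnormal k
      rw [hγ] at this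
      have h5 := (Complex.continuous_re.tendsto _).comp this
      have e : (((γ : ℂ) * γ) ^ (k + 1)).re = (γ * γ) ^ (k + 1) := by
        rw [← Complex.ofReal_mul, ← Complex.ofReal_pow, Complex.ofReal_re]
      rw [e] at h5
      convert! h5 using 2 with m
      simp only [Function.comp]
      rw [← block_prod, ← pur_psi, Complex.ofReal_re]
    have := le_of_tendsto_of_tendsto ((l1.pow 2).const_mul ((1 - ε ^ 2) ^ 2)) (l2.const_mul ((D : ℝ) ^ 2)) 
      ((hN.eventually_gt_atTop N₀).mono fun m hm => key2 _ hm _)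
    simpa using this
  have hlim : Tendsto (fun k : ℕ => (D : ℝ) ^ 2 * (γ * γ) ^ (k + 1)) atTop (𝓝 0) := by
    have := ((tendsto_pow_atTop_nhds_zero_of_lt_one (by positivity) (by nlinarith : γ * γ < 1)).comp (tendsto_add_atTop_nat 1)).const_mul ((D : ℝ) ^ 2)
    simpa using this
  have := ge_of_tendsto' hlim key3
  have h0 : 0 < 1 - ε ^ 2 := by nlinarith
  have : 0 < (1 - ε ^ 2) ^ 2 := by positivity
  linarith

theorem statement_1
    (d D₁ : ℕ) (hd : 0 < d) (hD₁ : 0 < D₁)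
    (A : Fin d → Matrix (Fin D₁) (Fin D₁) ℂ)
    -- left canonical form
    (hcanon : ∑ i, (A i)ᴴ * A i = 1)
    -- normality: E^m → (vec Λ)·(vec 1)ᵀ with Λ positive definite of trace one
    (Λ : Matrix (Fin D₁) (Fin D₁) ℂ) (hΛ : Λ.PosDef) (hΛtr : Λ.trace = 1)
    (hnormal : ∀ p q : Fin D₁ × Fin D₁,
      Filter.Tendsto (fun m => (transferE A ^ m) p q) Filter.atTop
        (nhds (Λ p.1 p.2 * (1 : Matrix (Fin D₁) (Fin D₁) ℂ) q.1 q.2)))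
    (D : ℕ) (hD : 1 ≤ D) (ε : ℝ) (hε0 : 0 ≤ ε) (hεD : ε < 1 / (4 * D))
    (N₀ : ℕ)
    -- for every `N > N₀`, `ψ_N(A) ≠ 0` and its normalization has the MPS-up(ε, D) property
    (hup : ∀ N : ℕ, N₀ < N → psiTI N A ≠ 0 ∧
      ∀ S : Finset (Fin N), ∃ φ : (Fin N → Fin d) → ℂ,
        l2norm (fun i => psiTI N A i / (l2norm (psiTI N A) : ℂ) - φ i) ≤ ε ∧
        schmidtRank φ S ≤ D) :
    ∀ N : ℕ, ∃ (K : ℂ) (φ : Fin d → ℂ),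
      ∀ i : Fin N → Fin d, psiTI N A i = K * ∏ n, φ (i n) := by
  rcases Nat.lt_or_ge D₁ 2 with h | h
  · obtain rfl : D₁ = 1 := by omega
    intro N
    refine ⟨1, fun a => A a 0 0, fun i => ?_⟩
    have key : ∀ l : List (Matrix (Fin 1) (Fin 1) ℂ), l.prod 0 0 = (l.map fun M => M 0 0).prod := by
      intro l
      induction l with
      | nil => simp
      | cons a l ih => simp [Matrix.mul_apply, ih]
    rw [psiTI, Matrix.trace_fin_one, key, List.map_ofFn, List.prod_ofFn, one_mul]
    rfl
  · refine (final_ineq h A Λ hΛ hΛtr hnormal D ε hε0 ?_ N₀ hup).elim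
    refine hεD.trans_le ?_
    have : (1 : ℝ) ≤ D := by exact_mod_cast hD
    rw [div_le_one (by positivity)]
    linarith
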